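/- arXiv:1004.3472 — 2 statements merged into one kernel-verified Lean document; each statement's English description precedes it below -/
import Mathlib

section
/- Let I, I', J be finite subsets of ℕ with I ≺ I' ≺ J. If J starts with I (that is, I = J or I ≪ J), then I' starts with I. -/
/-- The Gabriel–Roiter order on subsets of ℕ = {1,2,3,…} (modelled as `ℕ+`):
`I ≺ J` iff `I ≠ J` and the least element of the symmetric difference
`(I \ J) ∪ (J \ I)` belongs to `J`. -/
def GRlt (I J : Set ℕ+) : Prop :=
  I ≠ J ∧ ∃ m ∈ (I \ J) ∪ (J \ I), (∀ k ∈ (I \ J) ∪ (J \ I), m ≤ k) ∧ m ∈ J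

/-- `I ≪ J` iff `I ⊊ J` and every element of `I` is smaller than every element
of `J \ I`. -/
def GRll (I J : Set ℕ+) : Prop :=
  I ⊂ J ∧ ∀ a ∈ I, ∀ b ∈ J \ I, a < b

/-- `GRstartsWith J I` means "`J` starts with `I`", i.e. `I = J` or `I ≪ J`. -/
def GRstartsWith (J I : Set ℕ+) : Prop :=
  I = J ∨ GRll I J

/-- Let `I, I', J` be finite subsets of `ℕ = {1,2,…}` with `I ≺ I' ≺ J`.
If `J` starts with `I`, then `I'` starts with `I`. -/
theorem startsWith_of_between (I I' J : Set ℕ+)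
    (hIfin : I.Finite) (hI'fin : I'.Finite) (hJfin : J.Finite)
    (h1 : GRlt I I') (h2 : GRlt I' J)
    (hJI : GRstartsWith J I) :
    GRstartsWith I' I := by
  obtain ⟨-, m, hm, hmin, hmI'⟩ := h1
  obtain ⟨-, n, hn, hnmin, hnJ⟩ := h2
  have hmI : m ∉ I := fun h => hm.elim (fun h' => h'.2 hmI') (fun h' => h'.2 h)
  have hnI' : n ∉ I' := fun h => hn.elim (fun h' => h'.2 hnJ) (fun h' => h'.2 h)
  have hnm : m ∉ J → n < m := fun h =>
    lt_of_le_of_ne (hnmin m (Or.inl ⟨hmI', h⟩)) (fun e => hnI' (e ▸ hmI'))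
  have hnI : n ∈ I → m ≤ n := fun h => hmin n (Or.inl ⟨h, hnI'⟩)
  rcases hJI with rfl | ⟨-, hlt⟩
  · exact absurd (hnm hmI) (not_lt.2 (hnI hnJ))
  have key : ∀ a ∈ I, a < m := by
    intro a ha
    by_cases hmJ : m ∈ J
    · exact hlt a ha m ⟨hmJ, hmI⟩
    · have hlt_nm := hnm hmJ
      exact (hlt a ha n ⟨hnJ, fun h => not_lt.2 (hnI h) hlt_nm⟩).trans hlt_nm
  refine Or.inr ⟨⟨fun a ha => ?_, fun h => hmI (h hmI')⟩, fun a ha b hb =>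
    (key a ha).trans_le (hmin b (Or.inr hb))⟩
  by_contra ha'
  exact not_lt.2 (hmin a (Or.inl ⟨ha, ha'⟩)) (key a ha)
end

section
/- Let I, I', J be finite nonempty subsets of ℕ with I ≺ I' ≺ J. If J = I ∪ {|J|}, where |J| denotes the maximal element of J (so in particular J ≠ I and |J| ∉ I), then |I'| > |J|, i.e., the maximal element of I' is strictly greater than the maximal element of J. -/
/-- Let `I, I', J` be finite nonempty subsets of `ℕ = {1,2,…}` (modelled as
finsets of `ℕ+`) with `I ≺ I' ≺ J`.  If `J = I ∪ {|J|}`, where `|J|` denotes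
the maximal element of `J`, then the maximal element of `I'` is strictly
greater than the maximal element of `J`. -/
theorem max_gt_of_between (I I' J : Finset ℕ+)
    (hI : I.Nonempty) (hI' : I'.Nonempty) (hJ : J.Nonempty)
    (h1 : GRlt ↑I ↑I') (h2 : GRlt ↑I' ↑J)
    (hJI : J = I ∪ {J.max' hJ}) :
    J.max' hJ < I'.max' hI' := by
  obtain ⟨-, p, hp, hpmin, hpI'⟩ := h1
  obtain ⟨-, m, hm, hmmin, hmJ⟩ := h2
  have hJmax : ∀ x ∈ J, x ≤ J.max' hJ := fun x hx => J.le_max' x hx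
  have hI'max : ∀ x ∈ I', x ≤ I'.max' hI' := fun x hx => I'.le_max' x hx
  have hmem : ∀ x, x ∈ J ↔ x ∈ I ∨ x = J.max' hJ := fun x => by
    conv_lhs => rw [hJI]
    simp [or_comm]
  generalize J.max' hJ = M at *
  generalize I'.max' hI' = N at *
  simp only [Set.mem_union, Set.mem_sdiff, Finset.mem_coe] at *
  by_contra! hNM
  have hpM : p ≤ M := (hI'max p hpI').trans hNM
  have hmM : m ≤ M := hJmax m hmJ
  have hpI : p ∉ I := by tauto
  have hmI' : m ∉ I' := by tauto
  rcases hmM.eq_or_lt with rfl | hlt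
  · have hpm : p ≠ m := fun h => hmI' (h ▸ hpI')
    have hpJ : p ∉ J := by rw [hmem]; tauto
    exact hpm (hpM.antisymm (hmmin p (Or.inl ⟨hpI', hpJ⟩)))
  · have hmI : m ∈ I := ((hmem m).1 hmJ).resolve_right hlt.ne
    have hple : p ≤ m := hpmin m (Or.inl ⟨hmI, hmI'⟩)
    have hpJ : p ∉ J := by
      rw [hmem]
      exact not_or.2 ⟨hpI, (hple.trans_lt hlt).ne⟩
    exact hmI' (hple.antisymm (hmmin p (Or.inl ⟨hpI', hpJ⟩)) ▸ hpI')
end
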